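/- arXiv:2110.08337 — 2 statements merged into one kernel-verified Lean document; each statement's English description precedes it below -/
import Mathlib

section
/- Let B ⊆ ℝ³ be an open set and let F = (F₁,F₂,F₃) : B → ℝ³ be a C^∞ vector field with F(x) ≠ 0 for every x ∈ B, the coefficient field of the Pfaffian form δξ = F₁ dx₁ + F₂ dx₂ + F₃ dx₃. Then δξ is locally integrable on B if and only if F · (∇×F) = 0 at every point of B. -/
open Set

/-- Partial derivative of `f : ℝⁿ → ℝ` in the `i`-th coordinate direction. -/
noncomputable def pd {n : ℕ} (f : (Fin n → ℝ) → ℝ) (i : Fin n) (x : Fin n → ℝ) : ℝ :=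
  fderiv ℝ f x (Pi.single i 1)

/-- The curl `∇×G` of a vector field `G : ℝ³ → ℝ³`. -/
noncomputable def curl (G : (Fin 3 → ℝ) → (Fin 3 → ℝ)) (x : Fin 3 → ℝ) : Fin 3 → ℝ :=
  ![pd (fun y => G y 2) 1 x - pd (fun y => G y 1) 2 x,
    pd (fun y => G y 0) 2 x - pd (fun y => G y 2) 0 x,
    pd (fun y => G y 1) 0 x - pd (fun y => G y 0) 1 x]

/-- The Pfaffian form with coefficients `F i` is integrable on `A` if there are `μ`
nowhere zero on `A` and a smooth `ψ` with `Fᵢ = μ · ∂ψ/∂xᵢ` on `A`. -/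
def IsIntegrablePfaffOn {n : ℕ} (F : Fin n → (Fin n → ℝ) → ℝ) (A : Set (Fin n → ℝ)) : Prop :=
  ∃ μ ψ : (Fin n → ℝ) → ℝ, (∀ x ∈ A, μ x ≠ 0) ∧ ContDiffOn ℝ (⊤ : ℕ∞) ψ A ∧
    ∀ i, ∀ x ∈ A, F i x = μ x * pd ψ i x

/-- Local integrability on `B`: every point of `B` has an open neighborhood contained
in `B` on which the form is integrable. -/
def IsLocallyIntegrablePfaffOn {n : ℕ} (F : Fin n → (Fin n → ℝ) → ℝ)
    (B : Set (Fin n → ℝ)) : Prop :=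
  ∀ p ∈ B, ∃ A : Set (Fin n → ℝ), A ⊆ B ∧ IsOpen A ∧ p ∈ A ∧ IsIntegrablePfaffOn F A

open scoped Topology ContDiff unitInterval

section PostcompSmooth

variable {X : Type*} [TopologicalSpace X] [CompactSpace X]

/-- Pointwise evaluation of a continuous family of linear maps on a continuous family of
vectors, as a continuous bilinear map. -/
noncomputable def ContinuousMap.pointwiseApplyCLM (X : Type*) [TopologicalSpace X] [CompactSpace X]
    (E F : Type*) [NormedAddCommGroup E] [NormedSpace ℝ E] [NormedAddCommGroup F]
    [NormedSpace ℝ F] : C(X, E →L[ℝ] F) →L[ℝ] C(X, E) →L[ℝ] C(X, F) :=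
  LinearMap.mkContinuous₂
    (LinearMap.mk₂ ℝ (fun (A : C(X, E →L[ℝ] F)) (h : C(X, E)) =>
        (⟨fun x => A x (h x), by fun_prop⟩ : C(X, F)))
      (fun _ _ _ => by ext; simp) (fun _ _ _ => by ext; simp)
      (fun _ _ _ => by ext; simp) (fun _ _ _ => by ext; simp)) 1
    (fun A h => by
      rw [one_mul]
      refine (ContinuousMap.norm_le _ (by positivity)).2 fun x => ?_
      exact (A x).le_of_opNorm_le_of_le (A.norm_coe_le_norm x) (h.norm_coe_le_norm x))

@[simp]
theorem ContinuousMap.pointwiseApplyCLM_apply {E F : Type*} [NormedAddCommGroup E]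
    [NormedSpace ℝ E] [NormedAddCommGroup F] [NormedSpace ℝ F] (A : C(X, E →L[ℝ] F))
    (h : C(X, E)) (x : X) : ContinuousMap.pointwiseApplyCLM X E F A h x = A x (h x) := rfl

theorem ContDiff.hasFDerivAt_postcomp {E F : Type*} [NormedAddCommGroup E] [NormedSpace ℝ E]
    [NormedAddCommGroup F] [NormedSpace ℝ F] {g : E → F} (hg : ContDiff ℝ 1 g) (a : C(X, E)) :
    HasFDerivAt (fun b : C(X, E) => (⟨g, hg.continuous⟩ : C(E, F)).comp b)
      (ContinuousMap.pointwiseApplyCLM X E F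
        ((⟨fderiv ℝ g, hg.continuous_fderiv one_ne_zero⟩ : C(E, E →L[ℝ] F)).comp a)) a := by
  set D : C(E, E →L[ℝ] F) := ⟨fderiv ℝ g, hg.continuous_fderiv one_ne_zero⟩ with hD
  rw [hasFDerivAt_iff_isLittleO, Asymptotics.isLittleO_iff]
  intro ε hε
  have hDc : ContinuousAt (fun b : C(X, E) => D.comp b) a :=
    (D.continuous_postcomp (X := X)).continuousAt
  have hev : ∀ᶠ b in 𝓝 a, Dist.dist (D.comp b) (D.comp a) < ε :=
    hDc (Metric.ball_mem_nhds (D.comp a) hε)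
  obtain ⟨δ, hδ, hball⟩ := Metric.eventually_nhds_iff_ball.1 hev
  filter_upwards [Metric.ball_mem_nhds a hδ] with b hb
  refine (ContinuousMap.norm_le _ (by positivity)).2 fun x => ?_
  have hseg : ∀ y ∈ segment ℝ (a x) (b x), ‖fderiv ℝ g y - fderiv ℝ g (a x)‖ ≤ ε := by
    intro y hy
    rw [segment_eq_image_lineMap] at hy
    obtain ⟨t, ht, rfl⟩ := hy
    have hc : AffineMap.lineMap a b t ∈ Metric.ball a δ := by
      refine (convex_ball a δ).segment_subset (Metric.mem_ball_self hδ) hb ?_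
      rw [segment_eq_image_lineMap]
      exact ⟨t, ht, rfl⟩
    have := (ContinuousMap.dist_apply_le_dist x).trans (hball _ hc).le
    rw [dist_eq_norm] at this
    simpa [D, AffineMap.lineMap_apply] using this
  have := (convex_segment (𝕜 := ℝ) (a x) (b x)).norm_image_sub_le_of_norm_hasFDerivWithin_le'
    (f := g) (f' := fderiv ℝ g) (φ := fderiv ℝ g (a x)) (C := ε)
    (fun y _ => ((hg.differentiable one_ne_zero) y).hasFDerivAt.hasFDerivWithinAt) hseg
    (left_mem_segment ℝ _ _) (right_mem_segment ℝ _ _)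
  refine le_trans (by simpa [D] using this) ?_
  gcongr
  exact (b - a).norm_coe_le_norm x

universe u

theorem ContDiff.postcomp_nat {E : Type u} [NormedAddCommGroup E] [NormedSpace ℝ E] (n : ℕ) :
    ∀ {F : Type u} [NormedAddCommGroup F] [NormedSpace ℝ F] {g : E → F} (_ : ContDiff ℝ n g)
      (hc : Continuous g), ContDiff ℝ n (fun b : C(X, E) => (⟨g, hc⟩ : C(E, F)).comp b) := by
  induction n with
  | zero =>
    intro F _ _ g _ hc
    exact contDiff_zero.2 (ContinuousMap.continuous_postcomp _)
  | succ n ih =>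
    intro F _ _ g hg hc
    have h1 : ContDiff ℝ 1 g := hg.of_le (by norm_cast; omega)
    have hd := fun a : C(X, E) => h1.hasFDerivAt_postcomp a
    push_cast at hg ⊢
    refine contDiff_succ_iff_fderiv.2 ⟨fun a => (hd a).differentiableAt, by simp, ?_⟩
    rw [funext fun a => (hd a).fderiv]
    exact (ContinuousMap.pointwiseApplyCLM X E F).contDiff.comp
      (ih (contDiff_succ_iff_fderiv.1 hg).2.2 _)

theorem ContDiff.postcomp {E F : Type u} [NormedAddCommGroup E] [NormedSpace ℝ E]
    [NormedAddCommGroup F] [NormedSpace ℝ F] {g : E → F} (hg : ContDiff ℝ ∞ g) :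
    ContDiff ℝ ∞ (fun b : C(X, E) => (⟨g, hg.continuous⟩ : C(E, F)).comp b) :=
  contDiff_infty.2 fun n => ContDiff.postcomp_nat n (contDiff_infty.1 hg n) _

end PostcompSmooth

/-- The primitive vanishing at `0`, as a continuous linear operator on `C(I, ℝ)`. -/
noncomputable def primitiveCLM : C(I, ℝ) →L[ℝ] C(I, ℝ) :=
  LinearMap.mkContinuous
    { toFun := fun f => ⟨fun t => ∫ s in (0 : ℝ)..t, f (projIcc 0 1 zero_le_one s), by
        have hc : Continuous fun s : ℝ => f (projIcc 0 1 zero_le_one s) := by fun_prop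
        exact (intervalIntegral.continuous_primitive
          (fun a b => hc.intervalIntegrable a b) 0).comp continuous_subtype_val⟩
      map_add' := fun f g => by
        ext t
        exact intervalIntegral.integral_add
          (Continuous.intervalIntegrable (by fun_prop) _ _)
          (Continuous.intervalIntegrable (by fun_prop) _ _)
      map_smul' := fun c f => by
        ext t
        exact intervalIntegral.integral_const_mul c _ } 1
    (fun f => by
      rw [one_mul]
      refine (ContinuousMap.norm_le _ (norm_nonneg _)).2 fun t => ?_
      refine (intervalIntegral.norm_integral_le_of_norm_le_const
        fun s _ => f.norm_coe_le_norm _).trans ?_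
      rw [sub_zero, abs_of_nonneg t.2.1]
      exact mul_le_of_le_one_right (norm_nonneg _) t.2.2)

theorem primitiveCLM_apply (f : C(I, ℝ)) (t : I) :
    primitiveCLM f t = ∫ s in (0 : ℝ)..t, f (projIcc 0 1 zero_le_one s) := rfl

/-- A smooth family of self-maps whose derivative in the second variable vanishes at a fixed
point has a smooth family of fixed points. -/
theorem exists_smooth_family_fixedPoint {E W : Type*} [NormedAddCommGroup E] [NormedSpace ℝ E]
    [CompleteSpace E] [NormedAddCommGroup W] [NormedSpace ℝ W] [CompleteSpace W]
    {T : E × W → W} (hT : ContDiff ℝ ∞ T) {p : E} {w₀ : W} (h0 : T (p, w₀) = w₀)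
    (hD : ∀ h, fderiv ℝ T (p, w₀) (0, h) = 0) :
    ∃ w : E → W, w p = w₀ ∧ ∀ᶠ x in 𝓝 p, ContDiffAt ℝ ∞ w x ∧ T (x, w x) = w x := by
  set f : E × W → E × W := fun z => (z.1, z.2 - T z) with hf
  have hfs : ContDiff ℝ ∞ f := contDiff_fst.prodMk (contDiff_snd.sub hT)
  set D := fderiv ℝ T (p, w₀) with hDdef
  have hDv : ∀ v h, D (v, h) = D (v, 0) := fun v h => by
    have : (v, h) = (v, (0 : W)) + (0, h) := by simp
    rw [this, map_add, hD, add_zero]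
  set f' : (E × W) ≃L[ℝ] (E × W) := ContinuousLinearEquiv.equivOfInverse
    ((ContinuousLinearMap.fst ℝ E W).prod (ContinuousLinearMap.snd ℝ E W - D))
    ((ContinuousLinearMap.fst ℝ E W).prod (ContinuousLinearMap.snd ℝ E W + D))
    (fun z => by
      refine Prod.ext rfl ?_
      have h1 := hDv z.1 (z.2 - D z)
      have h2 := hDv z.1 z.2
      simp only [Prod.mk.eta] at h2
      simp [h1, ← h2])
    (fun z => by
      refine Prod.ext rfl ?_
      have h1 := hDv z.1 (z.2 + D z)
      have h2 := hDv z.1 z.2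
      simp only [Prod.mk.eta] at h2
      simp [h1, ← h2]) with hf'
  have hTd : Differentiable ℝ T := hT.differentiable (by simp)
  have hfd : HasFDerivAt f (f' : E × W →L[ℝ] E × W) (p, w₀) :=
    hasFDerivAt_fst.prodMk (hasFDerivAt_snd.sub (hTd _).hasFDerivAt)
  have hn : (∞ : WithTop ℕ∞) ≠ 0 := by simp
  set e := hfs.contDiffAt.toOpenPartialHomeomorph f hfd hn with he
  have hfp : f (p, w₀) = (p, 0) := by simp [hf, h0]
  have htgt : (p, (0 : W)) ∈ e.target :=
    hfp ▸ hfs.contDiffAt.image_mem_toOpenPartialHomeomorph_target hfd hn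
  have hsymm : e.symm (p, 0) = (p, w₀) := by
    rw [← hfp]
    exact e.left_inv (hfs.contDiffAt.mem_toOpenPartialHomeomorph_source hfd hn)
  have hin : ContinuousAt (fun x : E => (x, (0 : W))) p := by fun_prop
  refine ⟨fun x => (e.symm (x, 0)).2, by simp [hsymm], ?_⟩
  have hcont : ContinuousAt (fun x : E => fderiv ℝ f (e.symm (x, 0))) p := by
    refine (hfs.continuous_fderiv hn).continuousAt.comp ?_
    exact ContinuousAt.comp (f := fun x : E => (x, (0 : W))) (e.continuousAt_symm htgt) hin
  have hinv : ∀ᶠ x in 𝓝 p, fderiv ℝ f (e.symm (x, 0)) ∈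
      range ((↑) : ((E × W) ≃L[ℝ] (E × W)) → (E × W →L[ℝ] E × W)) := by
    refine hcont.eventually_mem ?_
    rw [hsymm, hfd.fderiv]
    exact ContinuousLinearEquiv.nhds f'
  filter_upwards [hinv, hin.eventually_mem (e.open_target.mem_nhds htgt)] with x ⟨g', hg'⟩ hx
  refine ⟨?_, ?_⟩
  · have : ContDiffAt ℝ ∞ e.symm (x, 0) := by
      refine e.contDiffAt_symm hx (f₀' := g') ?_ hfs.contDiffAt
      rw [hg']
      exact ((hfs.differentiable hn) _).hasFDerivAt
    exact contDiffAt_snd.comp x (this.comp x (contDiffAt_id.prodMk contDiffAt_const))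
  · have h := e.right_inv hx
    change f (e.symm (x, 0)) = (x, 0) at h
    have h1 : (e.symm (x, 0)).1 = x := congrArg Prod.fst h
    have h2 : (e.symm (x, 0)).2 - T (e.symm (x, 0)) = 0 := congrArg Prod.snd h
    rw [sub_eq_zero] at h2
    nth_rewrite 1 [← h1]
    exact h2.symm

theorem exists_contDiff_eventuallyEq {E F : Type*} [NormedAddCommGroup E] [NormedSpace ℝ E]
    [HasContDiffBump E] [NormedAddCommGroup F] [NormedSpace ℝ F] {f : E → F} {p : E}
    (hf : ∀ᶠ x in 𝓝 p, ContDiffAt ℝ ∞ f x) : ∃ g, ContDiff ℝ ∞ g ∧ g =ᶠ[𝓝 p] f := by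
  obtain ⟨r, hr, hball⟩ := Metric.nhds_basis_closedBall.mem_iff.1 hf
  let χ : ContDiffBump p := ⟨r / 2, r, half_pos hr, half_lt_self hr⟩
  refine ⟨fun x => χ x • f x, contDiff_iff_contDiffAt.2 fun x => ?_, ?_⟩
  · by_cases hx : x ∈ Metric.closedBall p r
    · exact χ.contDiffAt.smul (hball hx)
    · have : (fun x => χ x • f x) =ᶠ[𝓝 x] fun _ => 0 := by
        filter_upwards [Metric.isClosed_closedBall.isOpen_compl.mem_nhds hx] with y hy
        have : χ y = 0 := χ.zero_of_le_dist (le_of_lt (by simpa using hy))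
        simp [this]
      exact contDiffAt_const.congr_of_eventuallyEq this
  · filter_upwards [χ.eventuallyEq_one] with x hx
    simp [hx]

/-- Uniqueness for the linearised ray equation: along a curve `γ` in the distribution `ker η`
obtained by lifting the segment from `x` to `p`, a variation field starting in the integrable
distribution `ker η` stays in it. -/
theorem eq_zero_of_variation_of_ray {E : Type*} [NormedAddCommGroup E] [NormedSpace ℝ E]
    {η : E → E →L[ℝ] ℝ} (hη : ContDiff ℝ ∞ η) {e p x v : E} {W H : ℝ → ℝ} {γ : ℝ → E}
    (hγ : γ = fun t => p + (1 - t) • (x - p) + W t • e)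
    (hW : ∀ t ∈ Icc (0 : ℝ) 1,
      HasDerivAt W (η (γ t) (x - p)) t)
    (hH : ∀ t ∈ Icc (0 : ℝ) 1, HasDerivAt H
      (fderiv ℝ η (γ t) ((1 - t) • v + H t • e) (x - p)
        + η (γ t) v) t)
    (hW0 : W 0 = 0) (hH0 : H 0 = 0) (hv : η x v = 0)
    (he : ∀ t ∈ Icc (0 : ℝ) 1, ∀ᶠ y in 𝓝 (γ t), η y e = 1)
    (hsymm : ∀ t ∈ Icc (0 : ℝ) 1, ∀ a b, η (γ t) a = 0 →
      η (γ t) b = 0 →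
      fderiv ℝ η (γ t) a b =
        fderiv ℝ η (γ t) b a) :
    H 1 = 0 := by
  set γ' : ℝ → E := fun t => -(x - p) + η (γ t) (x - p) • e with hγ'
  have hηd : Differentiable ℝ η := hη.differentiable (by simp)
  have h1 : ∀ t : ℝ, HasDerivAt (fun t : ℝ => 1 - t) (-1) t := fun t => by
    simpa using (hasDerivAt_id t).const_sub 1
  have hγd : ∀ t ∈ Icc (0 : ℝ) 1, HasDerivAt γ (γ' t) t := fun t ht => by
    have := (((h1 t).smul_const (x - p)).const_add p).add ((hW t ht).smul_const e)
    rw [hγ]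
    refine this.congr_deriv ?_
    simp [hγ']
  set k : ℝ → ℝ := fun t => η (γ t) ((1 - t) • v) + H t with hk
  have hηγ : ∀ t ∈ Icc (0 : ℝ) 1, HasDerivAt (fun t => η (γ t)) (fderiv ℝ η (γ t) (γ' t)) t :=
    fun t ht => (hηd (γ t)).hasFDerivAt.comp_hasDerivAt t (hγd t ht)
  have hkd : ∀ t ∈ Icc (0 : ℝ) 1, HasDerivAt k (-(k t * fderiv ℝ η (γ t) e (γ' t))) t := by
    intro t ht
    have hd := ((hηγ t ht).clm_apply ((h1 t).smul_const v)).add (hH t ht)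
    refine hd.congr_deriv ?_
    have het : η (γ t) e = 1 := (he t ht).self_of_nhds
    have hDe : ∀ a, fderiv ℝ η (γ t) a e = 0 := fun a => by
      have hev : (fun y => η y e) =ᶠ[𝓝 (γ t)] fun _ => 1 := he t ht
      have h2 : HasFDerivAt (fun y => η y e) ((fderiv ℝ η (γ t)).flip e) (γ t) := by
        simpa using (hηd (γ t)).hasFDerivAt.clm_apply (hasFDerivAt_const e (γ t))
      have h3 := h2.fderiv.symm.trans hev.fderiv_eq
      have := congrArg (fun L : E →L[ℝ] ℝ => L a) h3
      simpa using this
    have hker : η (γ t) (γ' t) = 0 := by simp [hγ', het]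
    have hkt : η (γ t) ((1 - t) • v + H t • e) = k t := by simp [hk, het]
    have hs := hsymm t ht (γ' t) ((1 - t) • v + H t • e - k t • e) hker
      (by rw [map_sub, hkt]; simp [het])
    have hxp : x - p = -γ' t + η (γ t) (x - p) • e := by simp [hγ']
    change fderiv ℝ η (γ t) (γ' t) ((1 - t) • v) + η (γ t) ((-1 : ℝ) • v)
      + (fderiv ℝ η (γ t) ((1 - t) • v + H t • e) (x - p) + η (γ t) v) = _
    have h4 : fderiv ℝ η (γ t) ((1 - t) • v + H t • e) (x - p) =
        -fderiv ℝ η (γ t) ((1 - t) • v + H t • e) (γ' t) := by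
      conv_lhs => rw [hxp]
      rw [map_add, map_neg, map_smul, hDe, smul_zero, add_zero]
    rw [h4]
    simp only [map_sub, map_add, map_smul, _root_.sub_apply,
      _root_.add_apply, _root_.smul_apply, hDe, smul_eq_mul] at hs ⊢
    linear_combination hs
  have hγc : ContinuousOn γ (Icc 0 1) := fun t ht => (hγd t ht).continuousAt.continuousWithinAt
  obtain ⟨K, hK⟩ := isCompact_Icc.exists_bound_of_continuousOn
    (f := fun t => fderiv ℝ η (γ t) e (γ' t)) (s := Icc (0 : ℝ) 1) (by
      have hfd := hη.continuous_fderiv (by simp)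
      have h5 := hfd.comp_continuousOn hγc
      have h6 := hη.continuous.comp_continuousOn hγc
      exact (h5.clm_apply continuousOn_const).clm_apply
        (continuousOn_const.add ((h6.clm_apply continuousOn_const).smul continuousOn_const)))
  have hzero := eq_zero_of_abs_deriv_le_mul_abs_self_of_eq_zero_right (K := K)
    (fun t ht => (hkd t ht).continuousAt.continuousWithinAt)
    (fun t ht => (hkd t (Ico_subset_Icc_self ht)).hasDerivWithinAt)
    (by simp [hk, hγ, hW0, hH0, hv]) (fun t ht => by
      rw [norm_neg, norm_mul, mul_comm]
      gcongr
      exact hK t (Ico_subset_Icc_self ht)) 1 (right_mem_Icc.2 zero_le_one)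
  simpa [hk] using hzero

/-- Smooth dependence on parameters of the solution on `[0, 1]` of the integral equation
`w t = ∫ s in 0..t, G (s, x, w s)` near a parameter `p` at which `0` is a degenerate solution,
together with the variational equation. -/
theorem exists_smooth_family_integral_equation {E : Type} [NormedAddCommGroup E] [NormedSpace ℝ E]
    [CompleteSpace E] {G : ℝ × E × ℝ → ℝ} (hG : ContDiff ℝ ∞ G) {p : E}
    (hG0 : ∀ s, G (s, p, 0) = 0) (hGD0 : ∀ s h, fderiv ℝ G (s, p, 0) (0, 0, h) = 0) :
    ∃ w : E → C(I, ℝ), w p = 0 ∧ ∀ᶠ x in 𝓝 p, ContDiffAt ℝ ∞ w x ∧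
      (∀ t : I, w x t = ∫ s in (0 : ℝ)..t, G ((projIcc 0 1 zero_le_one s : I), x,
        w x (projIcc 0 1 zero_le_one s))) ∧
      ∀ (v : E) (t : I), fderiv ℝ w x v t = ∫ s in (0 : ℝ)..t,
        fderiv ℝ G ((projIcc 0 1 zero_le_one s : I), x, w x (projIcc 0 1 zero_le_one s))
          (0, v, fderiv ℝ w x v (projIcc 0 1 zero_le_one s)) := by
  -- the affine map sending `(x, w)` to the curve `s ↦ (s, x, w s)`
  set L : E × C(I, ℝ) →L[ℝ] C(I, ℝ × E × ℝ) := LinearMap.mkContinuous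
    { toFun := fun z => ⟨fun s => (0, z.1, z.2 s), by fun_prop⟩
      map_add' := fun _ _ => by ext <;> simp
      map_smul' := fun _ _ => by ext <;> simp } 1 (fun z => by
        rw [one_mul]
        refine (ContinuousMap.norm_le _ (norm_nonneg _)).2 fun s => ?_
        simp only [LinearMap.coe_mk, AddHom.coe_mk, ContinuousMap.coe_mk, Prod.norm_mk, norm_zero]
        exact max_le (norm_nonneg _) (max_le (norm_fst_le z)
          ((z.2.norm_coe_le_norm s).trans (norm_snd_le z)))) with hL
  set a₀ : C(I, ℝ × E × ℝ) := ⟨fun s => (s, 0, 0), by fun_prop⟩ with ha₀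
  have hcurve : ∀ (x : E) (w : C(I, ℝ)) (s : I), (a₀ + L (x, w)) s = ((s : ℝ), x, w s) := by
    intro x w s
    simp [hL, ha₀]
  set N : C(I, ℝ × E × ℝ) → C(I, ℝ) := fun b => (⟨G, hG.continuous⟩ : C(_, ℝ)).comp b with hN
  set T : E × C(I, ℝ) → C(I, ℝ) := fun z => primitiveCLM (N (a₀ + L z)) with hTdef
  have hT : ContDiff ℝ ∞ T :=
    primitiveCLM.contDiff.comp (hG.postcomp.comp (contDiff_const.add L.contDiff))
  have hTd : ∀ (x : E) (w : C(I, ℝ)) (v : E) (h : C(I, ℝ)) (t : I),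
      fderiv ℝ T (x, w) (v, h) t = ∫ s in (0 : ℝ)..t,
        fderiv ℝ G ((projIcc 0 1 zero_le_one s : I), x, w (projIcc 0 1 zero_le_one s))
          (0, v, h (projIcc 0 1 zero_le_one s)) := by
    intro x w v h t
    have h1 : ContDiff ℝ 1 G := hG.of_le (by simp)
    have hL' : HasFDerivAt (fun z => a₀ + L z) L (x, w) := L.hasFDerivAt.const_add a₀
    have hN' := HasFDerivAt.comp (g := N) (x, w) (h1.hasFDerivAt_postcomp (a₀ + L (x, w))) hL'
    have h2 := HasFDerivAt.comp (x, w) (primitiveCLM.hasFDerivAt (x := N (a₀ + L (x, w)))) hN'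
    change HasFDerivAt T _ (x, w) at h2
    rw [h2.fderiv]
    change primitiveCLM _ t = _
    rw [primitiveCLM_apply]
    refine intervalIntegral.integral_congr fun s _ => ?_
    change fderiv ℝ G ((a₀ + L (x, w)) _) (L (v, h) _) = _
    rw [hcurve]
    rfl
  have hT0 : T (p, 0) = 0 := by
    ext t
    change primitiveCLM _ t = 0
    rw [primitiveCLM_apply]
    refine intervalIntegral.integral_zero_ae (Filter.Eventually.of_forall fun s _ => ?_)
    change G ((a₀ + L (p, 0)) _) = 0
    rw [hcurve]
    exact hG0 _
  have hTD0 : ∀ h, fderiv ℝ T (p, 0) (0, h) = 0 := by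
    intro h
    ext t
    rw [hTd]
    refine intervalIntegral.integral_zero_ae (Filter.Eventually.of_forall fun s _ => ?_)
    exact hGD0 _ _
  obtain ⟨w, hwp, hw⟩ := exists_smooth_family_fixedPoint hT hT0 hTD0
  have hvar : ∀ᶠ x in 𝓝 p, ∀ v, fderiv ℝ w x v = fderiv ℝ T (x, w x) (v, fderiv ℝ w x v) := by
    filter_upwards [hw.eventually_nhds] with x hx v
    have hwd : HasFDerivAt w (fderiv ℝ w x) x :=
      (hx.self_of_nhds.1.differentiableAt (by simp)).hasFDerivAt
    have h1 := (((hT.differentiable (by simp)) (x, w x)).hasFDerivAt).comp x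
      ((hasFDerivAt_id x).prodMk hwd)
    have h2 : (fun y => T (y, w y)) =ᶠ[𝓝 x] w := hx.mono fun y hy => hy.2
    have h3 := h2.fderiv_eq (𝕜 := ℝ)
    have h4 : HasFDerivAt (fun y => T (y, w y)) _ x := h1
    rw [h4.fderiv] at h3
    exact (congrArg (fun A : E →L[ℝ] C(I, ℝ) => A v) h3).symm
  refine ⟨w, hwp, ?_⟩
  filter_upwards [hw, hvar] with x hwx hvarx
  refine ⟨hwx.1, fun t => ?_, fun v t => ?_⟩
  · conv_lhs => rw [← hwx.2]
    change primitiveCLM _ t = _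
    rw [primitiveCLM_apply]
    refine intervalIntegral.integral_congr fun s _ => ?_
    change G ((a₀ + L (x, w x)) _) = _
    rw [hcurve]
  · conv_lhs => rw [hvarx v, hTd]

/-- Local Frobenius theorem for a smooth one-form normalised by `η e = 1`. -/
theorem exists_first_integral_of_normalized {E : Type} [NormedAddCommGroup E] [NormedSpace ℝ E]
    [CompleteSpace E] {η : E → E →L[ℝ] ℝ} (hη : ContDiff ℝ ∞ η) {p e : E}
    (he : ∀ᶠ x in 𝓝 p, η x e = 1)
    (hsymm : ∀ᶠ x in 𝓝 p, ∀ a b, η x a = 0 → η x b = 0 → fderiv ℝ η x a b = fderiv ℝ η x b a) :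
    ∃ ψ : E → ℝ, ∀ᶠ x in 𝓝 p, ContDiffAt ℝ ∞ ψ x ∧ ∃ c : ℝ, c ≠ 0 ∧ fderiv ℝ ψ x = c • η x := by
  set G : ℝ × E × ℝ → ℝ :=
    fun y => η (p + (1 - y.1) • (y.2.1 - p) + y.2.2 • e) (y.2.1 - p) with hG
  have hGs : ContDiff ℝ ∞ G := by
    refine ContDiff.clm_apply (hη.comp ?_) ?_ <;> fun_prop
  have hηd : Differentiable ℝ η := hη.differentiable (by simp)
  have hGd : ∀ (s : ℝ) (x : E) (r : ℝ) (v : E) (h : ℝ), fderiv ℝ G (s, x, r) (0, v, h) =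
      fderiv ℝ η (p + (1 - s) • (x - p) + r • e) ((1 - s) • v + h • e) (x - p)
        + η (p + (1 - s) • (x - p) + r • e) v := by
    intro s x r v h
    have hl : HasDerivAt (fun τ : ℝ => (s, x + τ • v, r + τ * h)) ((0 : ℝ), v, h) 0 := by
      refine (hasDerivAt_const _ _).prodMk (HasDerivAt.prodMk ?_ ?_)
      · simpa using ((hasDerivAt_id (0 : ℝ)).smul_const v).const_add x
      · simpa using ((hasDerivAt_id (0 : ℝ)).mul_const h).const_add r
    have hb : HasDerivAt (fun τ : ℝ => x + τ • v - p) v 0 := by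
      simpa using (((hasDerivAt_id (0 : ℝ)).smul_const v).const_add x).sub_const p
    have hc : HasDerivAt (fun τ : ℝ => p + (1 - s) • (x + τ • v - p) + (r + τ * h) • e)
        ((1 - s) • v + h • e) 0 := by
      refine ((hb.const_smul (1 - s)).const_add p).add (HasDerivAt.smul_const ?_ e)
      simpa using ((hasDerivAt_id (0 : ℝ)).mul_const h).const_add r
    have h1 := (((hGs.differentiable (by simp)) _).hasFDerivAt
      (x := (s, x + (0 : ℝ) • v, r + (0 : ℝ) * h))).comp_hasDerivAt (0 : ℝ) hl
    have h2 := ((hηd _).hasFDerivAt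
      (x := p + (1 - s) • (x + (0 : ℝ) • v - p) + (r + (0 : ℝ) * h) • e)).comp_hasDerivAt
        (0 : ℝ) hc
    have h3 := h1.unique (h2.clm_apply hb)
    simpa using h3
  obtain ⟨w, hwp, hw⟩ := exists_smooth_family_integral_equation hGs (p := p)
    (fun s => by simp [hG]) (fun s h => by rw [hGd]; simp)
  set ev : C(I, ℝ) →L[ℝ] ℝ := ContinuousMap.evalCLM ℝ (1 : I) with hev
  have hψd : ∀ {x}, ContDiffAt ℝ ∞ w x → ∀ v,
      fderiv ℝ (fun x => w x 1) x v = fderiv ℝ w x v 1 := by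
    intro x hx v
    have h1 : HasFDerivAt (fun x => w x 1) _ x :=
      ev.hasFDerivAt.comp x (hx.differentiableAt (by simp)).hasFDerivAt
    rw [h1.fderiv]
    rfl
  have hψs : ∀ {x}, ContDiffAt ℝ ∞ w x → ContDiffAt ℝ ∞ (fun x => w x 1) x := fun {x} hx =>
    ev.contDiff.contDiffAt.comp x hx
  have hψe : fderiv ℝ (fun x => w x 1) p e = 1 := by
    rw [hψd hw.self_of_nhds.1, hw.self_of_nhds.2.2]
    have : ∀ s ∈ uIcc (0 : ℝ) (1 : I), fderiv ℝ G ((projIcc 0 1 zero_le_one s : I), p,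
        w p (projIcc 0 1 zero_le_one s)) (0, e, fderiv ℝ w p e (projIcc 0 1 zero_le_one s))
          = 1 := by
      intro s _
      rw [hGd]
      simp [hwp, he.self_of_nhds]
    rw [intervalIntegral.integral_congr this]
    simp
  have hne : ∀ᶠ x in 𝓝 p, fderiv ℝ (fun x => w x 1) x e ≠ 0 := by
    have hc : ContinuousAt (fun x => fderiv ℝ (fun x => w x 1) x e) p :=
      ((hψs hw.self_of_nhds.1).continuousAt_fderiv (by simp)).clm_apply continuousAt_const
    exact hc.eventually_ne (by rw [hψe]; exact one_ne_zero)
  obtain ⟨r, hr, hball⟩ := Metric.mem_nhds_iff.1 (he.eventually_nhds.and hsymm)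
  have hnear : ∀ᶠ x in 𝓝 p, ‖x - p‖ + ‖w x‖ * ‖e‖ < r := by
    have hwc : ContinuousAt w p := hw.self_of_nhds.1.continuousAt
    have hc : ContinuousAt (fun x => ‖x - p‖ + ‖w x‖ * ‖e‖) p := by fun_prop
    exact hc.eventually_lt_const (by simpa [hwp] using hr)
  refine ⟨fun x => w x 1, ?_⟩
  filter_upwards [hw, hne, hnear, he] with x hwx hnex hnearx hex
  refine ⟨hψs hwx.1, _, hnex, ?_⟩
  have hkey : ∀ v, η x v = 0 → fderiv ℝ (fun x => w x 1) x v = 0 := by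
    intro v hv
    rw [hψd hwx.1]
    set h := fderiv ℝ w x v with hh
    set π : ℝ → I := projIcc 0 1 zero_le_one with hπ
    have hπc : Continuous π := continuous_projIcc
    set W : ℝ → ℝ := fun t => ∫ s in (0 : ℝ)..t, G (π s, x, w x (π s)) with hWdef
    set H : ℝ → ℝ := fun t => ∫ s in (0 : ℝ)..t, fderiv ℝ G (π s, x, w x (π s)) (0, v, h (π s))
      with hHdef
    have hcv : Continuous fun s => ((π s : ℝ), x, w x (π s)) := by fun_prop
    have hWI : ∀ t : I, W t = w x t := fun t => (hwx.2.1 t).symm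
    have hHI : ∀ t : I, H t = h t := fun t => (hwx.2.2 v t).symm
    have hWd : ∀ t, HasDerivAt W (G (π t, x, w x (π t))) t := fun t =>
      ((hGs.continuous.comp hcv).integral_hasStrictDerivAt 0 t).hasDerivAt
    have hHd : ∀ t, HasDerivAt H (fderiv ℝ G (π t, x, w x (π t)) (0, v, h (π t))) t := fun t => by
      refine (Continuous.integral_hasStrictDerivAt ?_ 0 t).hasDerivAt
      exact ((hGs.continuous_fderiv (by simp)).comp hcv).clm_apply (by fun_prop)
    have hmem : ∀ t ∈ Icc (0 : ℝ) 1,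
        p + (1 - t) • (x - p) + W t • e ∈ Metric.ball p r := by
      intro t ht
      rw [mem_ball_iff_norm, hWI ⟨t, ht⟩, add_assoc, add_sub_cancel_left]
      refine lt_of_le_of_lt (norm_add_le _ _) (lt_of_le_of_lt ?_ hnearx)
      rw [norm_smul, norm_smul]
      gcongr
      · refine mul_le_of_le_one_left (norm_nonneg _) ?_
        rw [Real.norm_eq_abs, abs_of_nonneg (by linarith [ht.2])]
        linarith [ht.1]
      · exact (w x).norm_coe_le_norm _
    have hH1 := eq_zero_of_variation_of_ray hη rfl (e := e) (p := p) (x := x) (v := v)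
      (W := W) (H := H)
      (fun t ht => by
        have := hWd t
        rw [hπ, projIcc_of_mem zero_le_one ht, ← hWI ⟨t, ht⟩] at this
        exact this)
      (fun t ht => by
        have := hHd t
        rw [hπ, projIcc_of_mem zero_le_one ht, ← hWI ⟨t, ht⟩, ← hHI ⟨t, ht⟩, hGd] at this
        exact this)
      (by simp [hWdef]) (by simp [hHdef]) hv
      (fun t ht => (hball (hmem t ht)).1) (fun t ht => (hball (hmem t ht)).2)
    rw [← hHI 1]
    exact hH1
  ext v
  have := hkey (v - η x v • e) (by simp [hex])
  rw [map_sub, map_smul, sub_eq_zero] at this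
  rw [this]
  simp [mul_comm]

/-- Local Frobenius theorem for a smooth one-form in a finite-dimensional space. -/
theorem exists_first_integral_of_symm_on_ker {E : Type} [NormedAddCommGroup E] [NormedSpace ℝ E]
    [FiniteDimensional ℝ E] {θ : E → E →L[ℝ] ℝ} {p : E} (hθ : ∀ᶠ x in 𝓝 p, ContDiffAt ℝ ∞ θ x)
    (hp : θ p ≠ 0)
    (hsymm : ∀ᶠ x in 𝓝 p, ∀ a b, θ x a = 0 → θ x b = 0 → fderiv ℝ θ x a b = fderiv ℝ θ x b a) :
    ∃ ψ : E → ℝ, ∀ᶠ x in 𝓝 p, ContDiffAt ℝ ∞ ψ x ∧ ∃ c : ℝ, c ≠ 0 ∧ θ x = c • fderiv ℝ ψ x := by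
  have := FiniteDimensional.complete ℝ E
  obtain ⟨e, he⟩ : ∃ e, θ p e ≠ 0 := by
    by_contra! h
    exact hp (ContinuousLinearMap.ext h)
  have hne : ∀ᶠ x in 𝓝 p, θ x e ≠ 0 :=
    (hθ.self_of_nhds.continuousAt.clm_apply continuousAt_const).eventually_ne he
  obtain ⟨η, hη, hηθ⟩ := exists_contDiff_eventuallyEq (p := p) (f := fun x => (θ x e)⁻¹ • θ x) (by
    filter_upwards [hθ, hne] with x hx hxe
    exact ((hx.clm_apply contDiffAt_const).inv hxe).smul hx)
  have hηe : ∀ᶠ x in 𝓝 p, η x e = 1 := by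
    filter_upwards [hηθ, hne] with x hx hxe
    simp [hx, hxe]
  obtain ⟨ψ, hψ⟩ := exists_first_integral_of_normalized hη hηe (by
    filter_upwards [hηθ.eventually_nhds, hne, hθ, hsymm] with x hx hxe hxθ hs a b ha hb
    have hxη := hx.self_of_nhds
    have hker : ∀ v, η x v = 0 → θ x v = 0 := fun v hv => by
      simpa [hxη, hxe] using hv
    have hd : DifferentiableAt ℝ θ x := hxθ.differentiableAt (by simp)
    have hinv : DifferentiableAt ℝ (fun y => (θ y e)⁻¹) x :=
      (hd.clm_apply (differentiableAt_const e)).inv hxe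
    rw [Filter.EventuallyEq.fderiv_eq hx, fderiv_fun_smul hinv hd]
    simp [hker a ha, hker b hb, hs a b (hker a ha) (hker b hb)])
  refine ⟨ψ, ?_⟩
  filter_upwards [hψ, hηθ, hne] with x ⟨hs, c, hc, hx⟩ hxη hxe
  refine ⟨hs, θ x e * c⁻¹, mul_ne_zero hxe (inv_ne_zero hc), ?_⟩
  rw [hx, hxη, smul_smul, smul_smul, inv_mul_cancel_right₀ hc, mul_inv_cancel₀ hxe, one_smul]

theorem fderiv_eq_sum_pd {n : ℕ} (f : (Fin n → ℝ) → ℝ) (x v : Fin n → ℝ) :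
    fderiv ℝ f x v = ∑ j, v j * pd f j x := by
  have hs : ∀ i : Fin n, (Pi.single i 1 : Fin n → ℝ) = fun j => if i = j then 1 else 0 := by
    intro i
    ext j
    simp [Pi.single_apply, eq_comm]
  simpa [pd, hs] using (fderiv ℝ f x).toLinearMap.pi_apply_eq_sum_univ v

theorem pd_pd_comm {n : ℕ} {f : (Fin n → ℝ) → ℝ} {x : Fin n → ℝ} (hf : ContDiffAt ℝ ∞ f x)
    (i j : Fin n) : pd (pd f i) j x = pd (pd f j) i x := by
  have hd : DifferentiableAt ℝ (fderiv ℝ f) x :=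
    (hf.fderiv_right (m := 1) (by rw [one_add_one_eq_two]; exact ENat.LEInfty.out)).differentiableAt
      one_ne_zero
  have h : ∀ k l, pd (pd f k) l x = fderiv ℝ (fderiv ℝ f) x (Pi.single l 1) (Pi.single k 1) := by
    intro k l
    have h1 : HasFDerivAt (pd f k) _ x := hd.hasFDerivAt.clm_apply
      (hasFDerivAt_const (Pi.single k 1 : Fin n → ℝ) x)
    rw [pd, h1.fderiv]
    simp
  rw [h, h]
  exact hf.isSymmSndFDerivAt (by rw [minSmoothness_of_isRCLikeNormedField]; exact ENat.LEInfty.out) _ _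

/-- The one-form with coefficient vector `a`. -/
noncomputable def pfaffForm (n : ℕ) : (Fin n → ℝ) →L[ℝ] (Fin n → ℝ) →L[ℝ] ℝ :=
  ∑ i, (ContinuousLinearMap.proj (R := ℝ) (φ := fun _ : Fin n => ℝ) i).smulRight
    (ContinuousLinearMap.proj (R := ℝ) (φ := fun _ : Fin n => ℝ) i)

theorem pfaffForm_apply {n : ℕ} (a v : Fin n → ℝ) : pfaffForm n a v = ∑ i, a i * v i := by
  simp [pfaffForm]

theorem sum_mul_curl_eq_zero_of_isIntegrable {F : (Fin 3 → ℝ) → (Fin 3 → ℝ)}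
    {A : Set (Fin 3 → ℝ)} (hA : IsOpen A) (hF : ContDiffOn ℝ ∞ F A)
    (h : IsIntegrablePfaffOn (fun i x => F x i) A) {x : Fin 3 → ℝ} (hx : x ∈ A)
    (hF0 : F x ≠ 0) : ∑ i, F x i * curl F x i = 0 := by
  obtain ⟨μ, ψ, -, hψ, hF'⟩ := h
  have hA' := hA.mem_nhds hx
  have hψx : ContDiffAt ℝ ∞ ψ x := hψ.contDiffAt hA'
  obtain ⟨i, hi⟩ := Function.ne_iff.1 hF0
  have hpd : ∀ j, DifferentiableAt ℝ (pd ψ j) x := fun j =>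
    ((hψx.fderiv_right (m := 1) (by rw [one_add_one_eq_two]; exact ENat.LEInfty.out)).differentiableAt
      one_ne_zero).clm_apply
      (differentiableAt_const _)
  have hFi : DifferentiableAt ℝ (fun y => F y i) x :=
    differentiableAt_pi.1 ((hF.contDiffAt hA').differentiableAt (by simp)) i
  have hne : pd ψ i x ≠ 0 := fun h0 => hi (by simpa [h0] using hF' i x hx)
  set ν : (Fin 3 → ℝ) → ℝ := fun y => F y i * (pd ψ i y)⁻¹ with hν
  have hνd : DifferentiableAt ℝ ν x := hFi.mul ((hpd i).inv hne)
  have hFν : ∀ j, (fun y => F y j) =ᶠ[𝓝 x] fun y => ν y * pd ψ j y := fun j => by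
    filter_upwards [hA', (hpd i).continuousAt.eventually_ne hne] with y hy hy0
    have h1 := hF' i y hy
    have h2 := hF' j y hy
    simp only at h1 h2
    rw [hν]
    simp only
    rw [h1, h2, mul_inv_cancel_right₀ hy0]
  have hd : ∀ j k, pd (fun y => F y j) k x =
      ν x * pd (pd ψ j) k x + pd ν k x * pd ψ j x := by
    intro j k
    rw [pd, (hFν j).fderiv_eq, fderiv_fun_mul hνd (hpd j)]
    simp [pd, mul_comm]
  have hx0 : ∀ j, F x j = ν x * pd ψ j x := fun j => (hFν j).self_of_nhds
  have hc := pd_pd_comm hψx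
  simp only [Fin.sum_univ_three, curl, hd, hx0, Matrix.cons_val_zero, Matrix.cons_val_one,
    Matrix.cons_val, hc 1 0, hc 2 0, hc 2 1]
  ring

theorem isLocallyIntegrable_of_sum_mul_curl_eq_zero {B : Set (Fin 3 → ℝ)} (hB : IsOpen B)
    {F : (Fin 3 → ℝ) → (Fin 3 → ℝ)} (hF : ContDiffOn ℝ ∞ F B) (hF0 : ∀ x ∈ B, F x ≠ 0)
    (h : ∀ x ∈ B, ∑ i, F x i * curl F x i = 0) :
    IsLocallyIntegrablePfaffOn (fun i x => F x i) B := by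
  intro p hp
  have hBp : ∀ᶠ x in 𝓝 p, x ∈ B := hB.mem_nhds hp
  have hFx : ∀ x ∈ B, ContDiffAt ℝ ∞ F x := fun x hx => hF.contDiffAt (hB.mem_nhds hx)
  obtain ⟨ψ, hψ⟩ := exists_first_integral_of_symm_on_ker (p := p)
    (θ := fun x => pfaffForm 3 (F x))
    (hBp.mono fun x hx => (pfaffForm 3).contDiff.contDiffAt.comp x (hFx x hx))
    (fun h0 => hF0 p hp (by
      ext i
      have := congrArg (fun L : (Fin 3 → ℝ) →L[ℝ] ℝ => L (Pi.single i 1)) h0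
      simpa [pfaffForm_apply, Pi.single_apply] using this))
    (by
      filter_upwards [hBp] with x hx a b ha hb
      have hd : DifferentiableAt ℝ F x := (hFx x hx).differentiableAt (by simp)
      have hform : ∀ u v, fderiv ℝ (fun x => pfaffForm 3 (F x)) x u v =
          ∑ i, (∑ j, u j * pd (fun y => F y i) j x) * v i := by
        intro u v
        have h1 : HasFDerivAt (fun x => pfaffForm 3 (F x)) _ x :=
          (pfaffForm 3).hasFDerivAt.comp x hd.hasFDerivAt
        rw [h1.fderiv]
        change pfaffForm 3 (fderiv ℝ F x u) v = _
        rw [pfaffForm_apply]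
        refine Finset.sum_congr rfl fun i _ => ?_
        rw [← fderiv_eq_sum_pd, fderiv_apply hd]
        rfl
      have hsq : 0 < F x 0 ^ 2 + F x 1 ^ 2 + F x 2 ^ 2 := by
        obtain ⟨i, hi⟩ := Function.ne_iff.1 (hF0 x hx)
        have := pow_pos (abs_pos.2 hi) 2
        rw [sq_abs] at this
        fin_cases i <;> simp at this <;> positivity
      have hcurl := h x hx
      rw [hform, hform]
      rw [pfaffForm_apply] at ha hb
      refine mul_left_cancel₀ hsq.ne' ?_
      simp only [Fin.sum_univ_three, curl, Matrix.cons_val_zero, Matrix.cons_val_one,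
        Matrix.cons_val] at ha hb hcurl ⊢
      generalize pd (fun y => F y 0) 1 x = p01 at *
      generalize pd (fun y => F y 0) 2 x = p02 at *
      generalize pd (fun y => F y 1) 0 x = p10 at *
      generalize pd (fun y => F y 1) 2 x = p12 at *
      generalize pd (fun y => F y 2) 0 x = p20 at *
      generalize pd (fun y => F y 2) 1 x = p21 at *
      linear_combination (F x 0 * (a 1 * b 2 - a 2 * b 1) + F x 1 * (a 2 * b 0 - a 0 * b 2)
          + F x 2 * (a 0 * b 1 - a 1 * b 0)) * hcurl
        + ((F x 1 * (p10 - p01) - F x 2 * (p02 - p20)) * a 0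
          + (F x 2 * (p21 - p12) - F x 0 * (p10 - p01)) * a 1
          + (F x 0 * (p02 - p20) - F x 1 * (p21 - p12)) * a 2) * hb
        - ((F x 1 * (p10 - p01) - F x 2 * (p02 - p20)) * b 0
          + (F x 2 * (p21 - p12) - F x 0 * (p10 - p01)) * b 1
          + (F x 0 * (p02 - p20) - F x 1 * (p21 - p12)) * b 2) * ha)
  obtain ⟨A, hA, hAo, hpA⟩ := eventually_nhds_iff.1 (hψ.and hBp)
  choose! μ hμ using fun x hx => (hA x hx).1.2
  refine ⟨A, fun x hx => (hA x hx).2, hAo, hpA, μ, ψ, fun x hx => (hμ x hx).1,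
    fun x hx => (hA x hx).1.1.contDiffWithinAt, fun i x hx => ?_⟩
  have := congrArg (fun L : (Fin 3 → ℝ) →L[ℝ] ℝ => L (Pi.single i 1)) (hμ x hx).2
  simpa [pfaffForm_apply, Pi.single_apply, pd] using this

/-- A Pfaffian form in three variables with smooth, nowhere-vanishing coefficient field `F`
on an open set `B ⊆ ℝ³` is locally integrable on `B` iff `F · (∇×F) = 0` on `B`. -/
theorem pfaffian_three_variables_locally_integrable_iff
    (B : Set (Fin 3 → ℝ)) (hB : IsOpen B)
    (F : (Fin 3 → ℝ) → (Fin 3 → ℝ)) (hF : ContDiffOn ℝ (⊤ : ℕ∞) F B)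
    (hF0 : ∀ x ∈ B, F x ≠ 0) :
    IsLocallyIntegrablePfaffOn (fun i x => F x i) B ↔
      ∀ x ∈ B, ∑ i, F x i * curl F x i = 0 := by
  exact ⟨fun h x hx => by
      obtain ⟨A, hAB, hA, hxA, hint⟩ := h x hx
      exact sum_mul_curl_eq_zero_of_isIntegrable hA (hF.mono hAB) hint hxA (hF0 x hx),
    isLocallyIntegrable_of_sum_mul_curl_eq_zero hB hF hF0⟩
end

section
/- (Invariance of Clairaut's condition under change of variables) Let B, B̄ ⊆ ℝⁿ be open sets, let φ : B̄ → B be a C^∞ diffeomorphism, and let F₁,…,Fₙ : B → ℝ be C^∞ functions. Define F̄₁,…,F̄ₙ : B̄ → ℝ by F̄ⱼ(x̄) = Σ_{i=1}^{n} (∂φᵢ/∂x̄ⱼ)(x̄) · Fᵢ(φ(x̄)). If R_{ijk}(F) = 0 on B for all indices i, j, k, then R_{ijk}(F̄) = 0 on B̄ for all indices i, j, k. -/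
open Set

/-- The Clairaut quantity
`R_{ijk} = Fᵢ(∂F_k/∂xⱼ − ∂Fⱼ/∂x_k) + Fⱼ(∂Fᵢ/∂x_k − ∂F_k/∂xᵢ) + F_k(∂Fⱼ/∂xᵢ − ∂Fᵢ/∂xⱼ)`. -/
noncomputable def clairautR {n : ℕ} (F : Fin n → (Fin n → ℝ) → ℝ) (i j k : Fin n)
    (x : Fin n → ℝ) : ℝ :=
  F i x * (pd (F k) j x - pd (F j) k x) + F j x * (pd (F i) k x - pd (F k) i x)
    + F k x * (pd (F j) i x - pd (F i) j x)

theorem pd_comp {n : ℕ} {f : (Fin n → ℝ) → ℝ} {φ : (Fin n → ℝ) → (Fin n → ℝ)}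
    {x : Fin n → ℝ} (hf : DifferentiableAt ℝ f (φ x)) (hφ : DifferentiableAt ℝ φ x)
    (j : Fin n) :
    pd (fun y => f (φ y)) j x = ∑ b, pd (fun y => φ y b) j x * pd f b (φ x) := by
  have h : fderiv ℝ (fun y => f (φ y)) x = (fderiv ℝ f (φ x)).comp (fderiv ℝ φ x) :=
    fderiv_comp x hf hφ
  unfold pd
  rw [h, ContinuousLinearMap.comp_apply,
    pi_eq_sum_univ' (fderiv ℝ φ x (Pi.single j 1)), map_sum]
  refine Finset.sum_congr rfl fun b _ => ?_
  rw [map_smul, smul_eq_mul, fderiv_apply hφ]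
  congr 2

theorem ContDiffAt.differentiableAt_pd {n : ℕ} {f : (Fin n → ℝ) → ℝ} {x : Fin n → ℝ}
    (hf : ContDiffAt ℝ 2 f x) (i : Fin n) : DifferentiableAt ℝ (pd f i) x :=
  ((hf.fderiv_right (m := 1) (by norm_num)).differentiableAt one_ne_zero).clm_apply
    (differentiableAt_const _)

theorem ContDiffAt.pd_comm {n : ℕ} {f : (Fin n → ℝ) → ℝ} {x : Fin n → ℝ}
    (hf : ContDiffAt ℝ 2 f x) (i j : Fin n) : pd (pd f i) j x = pd (pd f j) i x := by
  have hd : DifferentiableAt ℝ (fderiv ℝ f) x :=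
    (hf.fderiv_right (m := 1) (by norm_num)).differentiableAt one_ne_zero
  have key (i j : Fin n) :
      pd (pd f i) j x = fderiv ℝ (fderiv ℝ f) x (Pi.single j 1) (Pi.single i 1) := by
    change fderiv ℝ (fun y => fderiv ℝ f y (Pi.single i 1)) x (Pi.single j 1) = _
    rw [fderiv_clm_apply hd (differentiableAt_const _)]
    simp
  rw [key, key]
  exact (hf.isSymmSndFDerivAt (by simp)) _ _

/-- The coefficients of the pullback along `φ` of the Pfaffian form with coefficients `F`. -/
noncomputable def pullbackCoeff {n : ℕ} (φ : (Fin n → ℝ) → (Fin n → ℝ))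
    (F : Fin n → (Fin n → ℝ) → ℝ) (j : Fin n) (x : Fin n → ℝ) : ℝ :=
  ∑ a, pd (fun y => φ y a) j x * F a (φ x)

section pullback

variable {n : ℕ} {φ : (Fin n → ℝ) → (Fin n → ℝ)} {F : Fin n → (Fin n → ℝ) → ℝ}
  {x : Fin n → ℝ}

theorem pd_pullbackCoeff (hφ : ContDiffAt ℝ 2 φ x)
    (hF : ∀ a, DifferentiableAt ℝ (F a) (φ x)) (k j : Fin n) :
    pd (pullbackCoeff φ F k) j x =
      ∑ a, pd (pd (fun y => φ y a) k) j x * F a (φ x) +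
      ∑ b, ∑ c, pd (fun y => φ y b) j x * pd (fun y => φ y c) k x * pd (F c) b (φ x) := by
  have hφ' : DifferentiableAt ℝ φ x := hφ.differentiableAt two_ne_zero
  have hP (a : Fin n) : DifferentiableAt ℝ (pd (fun y => φ y a) k) x :=
    (contDiffAt_pi.1 hφ a).differentiableAt_pd k
  have hFφ (a : Fin n) : DifferentiableAt ℝ (fun y => F a (φ y)) x := (hF a).comp x hφ'
  have h : pd (pullbackCoeff φ F k) j x =
      ∑ a, (pd (fun y => φ y a) k x * pd (fun y => F a (φ y)) j x +
        F a (φ x) * pd (pd (fun y => φ y a) k) j x) := by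
    change fderiv ℝ (fun y => ∑ a, pd (fun y => φ y a) k y * F a (φ y)) x (Pi.single j 1) = _
    rw [fderiv_fun_sum fun a _ => (hP a).fun_mul (hFφ a), _root_.sum_apply]
    refine Finset.sum_congr rfl fun a _ => ?_
    rw [fderiv_fun_mul (hP a) (hFφ a)]
    rfl
  rw [h, Finset.sum_add_distrib, add_comm, Finset.sum_comm (γ := Fin n)]
  congr 1
  · exact Finset.sum_congr rfl fun a _ => mul_comm _ _
  · refine Finset.sum_congr rfl fun a _ => ?_
    rw [pd_comp (hF a) hφ', Finset.mul_sum]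
    exact Finset.sum_congr rfl fun b _ => by ring

theorem pd_pullbackCoeff_sub (hφ : ContDiffAt ℝ 2 φ x)
    (hF : ∀ a, DifferentiableAt ℝ (F a) (φ x)) (j k : Fin n) :
    pd (pullbackCoeff φ F k) j x - pd (pullbackCoeff φ F j) k x =
      ∑ b, ∑ c, pd (fun y => φ y b) j x * pd (fun y => φ y c) k x *
        (pd (F c) b (φ x) - pd (F b) c (φ x)) := by
  rw [pd_pullbackCoeff hφ hF, pd_pullbackCoeff hφ hF]
  simp_rw [fun a => (contDiffAt_pi.1 hφ a).pd_comm k j]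
  rw [add_sub_add_left_eq_sub, Finset.sum_comm (f := fun b c =>
    pd (fun y => φ y b) k x * pd (fun y => φ y c) j x * pd (F c) b (φ x))]
  simp_rw [← Finset.sum_sub_distrib]
  exact Finset.sum_congr rfl fun b _ => Finset.sum_congr rfl fun c _ => by ring

/-- The Clairaut quantities transform as the components of a covariant 3-tensor. -/
theorem clairautR_pullbackCoeff (hφ : ContDiffAt ℝ 2 φ x)
    (hF : ∀ a, DifferentiableAt ℝ (F a) (φ x)) (i j k : Fin n) :
    clairautR (pullbackCoeff φ F) i j k x =
      ∑ a, ∑ b, ∑ c, pd (fun y => φ y a) i x * pd (fun y => φ y b) j x *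
        pd (fun y => φ y c) k x * clairautR F a b c (φ x) := by
  rw [clairautR, pd_pullbackCoeff_sub hφ hF, pd_pullbackCoeff_sub hφ hF,
    pd_pullbackCoeff_sub hφ hF]
  have rotate (f : Fin n → Fin n → Fin n → ℝ) :
      ∑ b, ∑ c, ∑ a, f a b c = ∑ a, ∑ b, ∑ c, f a b c :=
    (Finset.sum_congr rfl fun _ _ => Finset.sum_comm).trans Finset.sum_comm
  have expand (f : Fin n → ℝ) (g : Fin n → Fin n → ℝ) :
      (∑ a, f a) * ∑ b, ∑ c, g b c = ∑ a, ∑ b, ∑ c, f a * g b c := by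
    simp only [Finset.sum_mul _ f, Finset.mul_sum]
  simp only [pullbackCoeff, clairautR]
  rw [expand, expand, expand, rotate fun a b c =>
      pd (fun y => φ y b) j x * F b (φ x) *
        (pd (fun y => φ y c) k x * pd (fun y => φ y a) i x *
          (pd (F a) c (φ x) - pd (F c) a (φ x))),
    ← rotate fun c a b => pd (fun y => φ y c) k x * F c (φ x) *
        (pd (fun y => φ y a) i x * pd (fun y => φ y b) j x *
          (pd (F b) a (φ x) - pd (F a) b (φ x)))]
  simp_rw [← Finset.sum_add_distrib]
  refine Finset.sum_congr rfl fun a _ => Finset.sum_congr rfl fun b _ =>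
    Finset.sum_congr rfl fun c _ => ?_
  ring

end pullback

/-- (Invariance of Clairaut's condition under change of variables) If `φ : B̄ → B` is a
smooth diffeomorphism between open sets of `ℝⁿ`, `F₁,…,Fₙ` are smooth on `B`, and the
transformed coefficients are `F̄ⱼ(x̄) = Σᵢ (∂φᵢ/∂x̄ⱼ)(x̄) · Fᵢ(φ(x̄))`, then the vanishing
of `R_{ijk}(F)` on `B` implies the vanishing of `R_{ijk}(F̄)` on `B̄`. -/
theorem clairautR_invariant_change_of_variables
    (n : ℕ) (B Bb : Set (Fin n → ℝ)) (hB : IsOpen B) (hBb : IsOpen Bb)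
    (φ φinv : (Fin n → ℝ) → (Fin n → ℝ))
    (hφ : ContDiffOn ℝ (⊤ : ℕ∞) φ Bb) (hφinv : ContDiffOn ℝ (⊤ : ℕ∞) φinv B)
    (hbij : Set.BijOn φ Bb B) (hinv : ∀ x ∈ Bb, φinv (φ x) = x)
    (F : Fin n → (Fin n → ℝ) → ℝ) (hF : ∀ i, ContDiffOn ℝ (⊤ : ℕ∞) (F i) B)
    (hR : ∀ i j k, ∀ x ∈ B, clairautR F i j k x = 0) :
    ∀ i j k, ∀ x ∈ Bb,
      clairautR (fun j' x' => ∑ i', pd (fun y => φ y i') j' x' * F i' (φ x')) i j k x = 0 := by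
  intro i j k x hx
  have hφx : ContDiffAt ℝ 2 φ x :=
    (hφ.contDiffAt (hBb.mem_nhds hx)).of_le (WithTop.coe_le_coe.2 le_top)
  have hFx (a : Fin n) : DifferentiableAt ℝ (F a) (φ x) :=
    ((hF a).contDiffAt (hB.mem_nhds (hbij.mapsTo hx))).differentiableAt (by simp)
  refine (clairautR_pullbackCoeff hφx hFx i j k).trans ?_
  simp [hR _ _ _ _ (hbij.mapsTo hx)]
end
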